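/- There is no smooth function u : ℝ³ → ℝ and constant c > 0 with the following properties. For each x ∈ ℝ³ let ∇u(x) ∈ ℝ³ be the gradient of u, D²u(x) the Hessian matrix of u, W(x) = √(1 + ‖∇u(x)‖²), g(x) = I + ∇u(x)·∇u(x)ᵀ (a 3×3 matrix), and let A(x) = (1/W(x))·g(x)⁻¹·D²u(x) be the shape operator of the entire graph {(x, u(x)) : x ∈ ℝ³} ⊂ ℝ⁴. The forbidden properties are: (i) for every x ∈ ℝ³ the scalar curvature vanishes, i.e. σ₂(A(x)) := ((tr A(x))² − tr(A(x)²))/2 = 0; and (ii) for every x ∈ ℝ³, tr A(x) ≠ 0 and −det A(x)/(tr A(x))³ ≥ c. (Bernstein-type theorem: there are no entire graphs in ℝ⁴ with zero scalar curvature and (−K)/H³ ≥ c > 0 everywhere.) -/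

import Mathlib

open Matrix MeasureTheory

noncomputable section
namespace Bern

abbrev E3 := Fin 3 → ℝ

def D (i : Fin 3) (f : E3 → ℝ) (x : E3) : ℝ := fderiv ℝ f x (Pi.single i 1)

abbrev Sm (f : E3 → ℝ) : Prop := ContDiff ℝ (⊤ : ℕ∞) f

lemma Sm.D {f : E3 → ℝ} (hf : Sm f) (i : Fin 3) : Sm (D i f) := by
  have h : ContDiff ℝ (⊤ : ℕ∞) (fderiv ℝ f) := hf.fderiv_right (by simp)
  exact h.clm_apply contDiff_const

lemma Sm.da {f : E3 → ℝ} (hf : Sm f) (x : E3) : DifferentiableAt ℝ f x :=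
  (hf.differentiable (by simp)) x

lemma D_add {f g : E3 → ℝ} {x : E3} (i : Fin 3) (hf : DifferentiableAt ℝ f x)
    (hg : DifferentiableAt ℝ g x) :
    D i (fun y => f y + g y) x = D i f x + D i g x := by
  have := fderiv_fun_add hf hg
  simp [D, this]

lemma D_mul {f g : E3 → ℝ} {x : E3} (i : Fin 3) (hf : DifferentiableAt ℝ f x)
    (hg : DifferentiableAt ℝ g x) :
    D i (fun y => f y * g y) x = f x * D i g x + D i f x * g x := by
  have := fderiv_fun_mul hf hg
  simp [D, this]; ring

lemma D_sub {f g : E3 → ℝ} {x : E3} (i : Fin 3) (hf : DifferentiableAt ℝ f x)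
    (hg : DifferentiableAt ℝ g x) :
    D i (fun y => f y - g y) x = D i f x - D i g x := by
  have := fderiv_fun_sub hf hg
  simp [D, this]

lemma D_comp {χ : ℝ → ℝ} {f : E3 → ℝ} {x : E3} (i : Fin 3) (hf : DifferentiableAt ℝ f x) {c : ℝ}
    (hχ : HasDerivAt χ c (f x)) :
    D i (fun y => χ (f y)) x = c * D i f x := by
  have := (hχ.comp_hasFDerivAt x hf.hasFDerivAt).fderiv
  simp only [Function.comp_def] at this
  simp [D, this]

lemma D_coord (i j : Fin 3) (x : E3) : D i (fun y => y j) x = if i = j then 1 else 0 := by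
  have : fderiv ℝ (fun y : E3 => y j) x = ContinuousLinearMap.proj j :=
    (ContinuousLinearMap.proj (R := ℝ) (φ := fun _ : Fin 3 => ℝ) j).fderiv
  simp [D, this, Pi.single_apply, eq_comm]

lemma D_comm {f : E3 → ℝ} (hf : Sm f) (i j : Fin 3) (x : E3) :
    D i (D j f) x = D j (D i f) x := by
  have h2 : ContDiff ℝ (⊤ : ℕ∞) (fderiv ℝ f) := hf.fderiv_right (by simp)
  have hd : DifferentiableAt ℝ (fderiv ℝ f) x := (h2.differentiable (by simp)) x
  have key : ∀ v w : E3, fderiv ℝ (fun y => fderiv ℝ f y v) x w = fderiv ℝ (fderiv ℝ f) x w v := by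
    intro v w
    rw [fderiv_clm_apply hd (differentiableAt_const v)]
    simp
  have hs : IsSymmSndFDerivAt ℝ f x :=
    (hf.contDiffAt).isSymmSndFDerivAt (by simp; exact WithTop.coe_le_coe.2 le_top)
  show fderiv ℝ (fun y => fderiv ℝ f y _) x _ = fderiv ℝ (fun y => fderiv ℝ f y _) x _
  rw [key, key]
  exact hs _ _

lemma Sm.int {f : E3 → ℝ} (hf : Continuous f) (hc : HasCompactSupport f) : Integrable f :=
  hf.integrable_of_hasCompactSupport hc

lemma D_supp {f : E3 → ℝ} (hc : HasCompactSupport f) (i : Fin 3) : HasCompactSupport (D i f) :=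
  hc.fderiv_apply ℝ (Pi.single i 1)

lemma int_D {f : E3 → ℝ} (hf : Sm f) (hc : HasCompactSupport f) (i : Fin 3) :
    ∫ x, D i f x = 0 := by
  have h := integral_mul_fderiv_eq_neg_fderiv_mul_of_integrable (μ := (volume : Measure E3))
    (f := fun _ : E3 => (1:ℝ)) (g := f) (v := Pi.single i 1) (by simp)
    (by simp only [one_mul]; exact Sm.int (hf.D i).continuous (D_supp hc i))
    (by simpa using Sm.int hf.continuous hc) (fun x _ => differentiableAt_const _)
    (fun x _ => hf.da x)
  simp only [one_mul] at h
  exact h.trans (by simp)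

def det3 (a b c : Fin 3 → ℝ) : ℝ :=
  a 0 * (b 1 * c 2 - b 2 * c 1) + a 1 * (b 2 * c 0 - b 0 * c 2) + a 2 * (b 0 * c 1 - b 1 * c 0)

def G (f : E3 → ℝ) (x : E3) : Fin 3 → ℝ := fun i => D i f x

lemma int_sum3 {f0 f1 f2 : E3 → ℝ} (h0 : Sm f0) (h1 : Sm f1) (h2 : Sm f2)
    (c0 : HasCompactSupport f0) (c1 : HasCompactSupport f1) (c2 : HasCompactSupport f2) :
    ∫ x, (D 0 f0 x + D 1 f1 x + D 2 f2 x) = 0 := by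
  have i0 := Sm.int (h0.D 0).continuous (D_supp c0 0)
  have i1 := Sm.int (h1.D 1).continuous (D_supp c1 1)
  have i2 := Sm.int (h2.D 2).continuous (D_supp c2 2)
  have i01 : Integrable (fun x => D 0 f0 x + D 1 f1 x) := i0.add i1
  rw [integral_add i01 i2, integral_add i0 i1, int_D h0 c0, int_D h1 c1, int_D h2 c2]
  simp

lemma int_det {f a b : E3 → ℝ} (hf : Sm f) (hc : HasCompactSupport f) (ha : Sm a) (hb : Sm b) :
    ∫ x, det3 (G f x) (G a x) (G b x) = 0 := by
  have hC : ∀ i j, Sm (fun x => D i a x * D j b x - D j a x * D i b x) := fun i j =>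
    ((ha.D i).mul (hb.D j)).sub ((ha.D j).mul (hb.D i))
  have h := int_sum3 (hf.mul (hC 1 2)) (hf.mul (hC 2 0)) (hf.mul (hC 0 1))
    (hc.mul_right) (hc.mul_right) (hc.mul_right)
  rw [← h]
  congr 1
  ext x
  have e : ∀ i j k, D k (fun x => f x * (D i a x * D j b x - D j a x * D i b x)) x =
      D k f x * (D i a x * D j b x - D j a x * D i b x) + f x *
      ((D i a x * D k (D j b) x + D k (D i a) x * D j b x) -
       (D j a x * D k (D i b) x + D k (D j a) x * D i b x)) := by
    intro i j k
    rw [D_mul k (hf.da x) ((hC i j).da x), D_sub k (((ha.D i).da x).fun_mul ((hb.D j).da x))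
      (((ha.D j).da x).fun_mul ((hb.D i).da x)), D_mul k ((ha.D i).da x) ((hb.D j).da x),
      D_mul k ((ha.D j).da x) ((hb.D i).da x)]
    ring
  rw [e, e, e, D_comm ha 1 0, D_comm ha 2 0, D_comm ha 2 1, D_comm hb 1 0, D_comm hb 2 0,
    D_comm hb 2 1]
  simp only [det3, G]
  ring

/-! ### pointwise algebra -/

def dot (a b : Fin 3 → ℝ) : ℝ := a 0 * b 0 + a 1 * b 1 + a 2 * b 2

/-- `q p w a = |a|² - w² (a·p)²` -/
def q (p : Fin 3 → ℝ) (w : ℝ) (a : Fin 3 → ℝ) : ℝ := dot a a - w ^ 2 * dot a p ^ 2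

lemma hadamard (a b c : Fin 3 → ℝ) : det3 a b c ^ 2 ≤ dot a a * dot b b * dot c c := by
  have h1 : det3 a b c ^ 2 ≤ dot a a * (dot b b * dot c c - dot b c ^ 2) := by
    simp only [det3, dot]
    nlinarith [sq_nonneg (a 0 * (b 2 * c 0 - b 0 * c 2) - a 1 * (b 1 * c 2 - b 2 * c 1)),
      sq_nonneg (a 0 * (b 0 * c 1 - b 1 * c 0) - a 2 * (b 1 * c 2 - b 2 * c 1)),
      sq_nonneg (a 1 * (b 0 * c 1 - b 1 * c 0) - a 2 * (b 2 * c 0 - b 0 * c 2))]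
  have h2 : 0 ≤ dot a a := by
    simp only [dot]; nlinarith [sq_nonneg (a 0), sq_nonneg (a 1), sq_nonneg (a 2)]
  nlinarith [mul_nonneg h2 (sq_nonneg (dot b c))]

/-- the square root of the inverse metric -/
def B (p : Fin 3 → ℝ) (k : ℝ) (a : Fin 3 → ℝ) : Fin 3 → ℝ := fun i => a i - k * dot a p * p i

lemma det_B (p : Fin 3 → ℝ) (k : ℝ) (a b c : Fin 3 → ℝ) :
    det3 (B p k a) (B p k b) (B p k c) = (1 - k * dot p p) * det3 a b c := by
  simp only [det3, B, dot]; ring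

lemma dot_B (p : Fin 3 → ℝ) (k : ℝ) (a : Fin 3 → ℝ) :
    dot (B p k a) (B p k a) = dot a a - (2 * k - k ^ 2 * dot p p) * dot a p ^ 2 := by
  simp only [B, dot]; ring

lemma q_eq {p : Fin 3 → ℝ} {W : ℝ} (hW : 1 ≤ W) (hp : W ^ 2 = 1 + dot p p) (a : Fin 3 → ℝ) :
    q p W⁻¹ a = dot (B p (1 / (W * (W + 1))) a) (B p (1 / (W * (W + 1))) a) := by
  rw [dot_B, q]
  have : dot p p = W ^ 2 - 1 := by linarith
  rw [this]
  have h1 : W ≠ 0 := by positivity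
  have h2 : W + 1 ≠ 0 := by positivity
  have : 2 * (1 / (W * (W + 1))) - (1 / (W * (W + 1))) ^ 2 * (W ^ 2 - 1) = W⁻¹ ^ 2 := by
    field_simp; ring
  rw [this]

lemma dot_self_nonneg (a : Fin 3 → ℝ) : 0 ≤ dot a a := by
  simp only [dot]; nlinarith [sq_nonneg (a 0), sq_nonneg (a 1), sq_nonneg (a 2)]

lemma q_nonneg {p : Fin 3 → ℝ} {W : ℝ} (hW : 1 ≤ W) (hp : W ^ 2 = 1 + dot p p) (a : Fin 3 → ℝ) :
    0 ≤ q p W⁻¹ a := by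
  rw [q_eq hW hp]; exact dot_self_nonneg _

lemma hadamard_q {p : Fin 3 → ℝ} {W : ℝ} (hW : 1 ≤ W) (hp : W ^ 2 = 1 + dot p p)
    (a b c : Fin 3 → ℝ) :
    det3 a b c ^ 2 ≤ W ^ 2 * (q p W⁻¹ a * q p W⁻¹ b * q p W⁻¹ c) := by
  rw [q_eq hW hp, q_eq hW hp, q_eq hW hp]
  have h := hadamard (B p (1 / (W * (W + 1))) a) (B p (1 / (W * (W + 1))) b)
    (B p (1 / (W * (W + 1))) c)
  rw [det_B] at h
  have e : 1 - 1 / (W * (W + 1)) * dot p p = W⁻¹ := by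
    have : dot p p = W ^ 2 - 1 := by linarith
    rw [this]
    have h1 : W ≠ 0 := by positivity
    have h2 : W + 1 ≠ 0 := by positivity
    field_simp; ring
  rw [e] at h
  have h1 : W ≠ 0 := by positivity
  have e2 : det3 a b c ^ 2 = W ^ 2 * (W⁻¹ * det3 a b c) ^ 2 := by field_simp
  rw [e2]
  gcongr

lemma q_comb {p : Fin 3 → ℝ} {W : ℝ} (hW : 1 ≤ W) (hp : W ^ 2 = 1 + dot p p)
    (a b c : Fin 3 → ℝ) (s t : ℝ) (hc : ∀ i, c i = s * a i + t * b i) :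
    q p W⁻¹ c ≤ 2 * s ^ 2 * q p W⁻¹ a + 2 * t ^ 2 * q p W⁻¹ b := by
  have h := q_nonneg hW hp (fun i => s * a i - t * b i)
  have e : q p W⁻¹ c + q p W⁻¹ (fun i => s * a i - t * b i) =
      2 * s ^ 2 * q p W⁻¹ a + 2 * t ^ 2 * q p W⁻¹ b := by
    simp only [q, dot, hc]; ring
  linarith

/-- shape operator in coordinates -/
def Am (p : Fin 3 → ℝ) (h : Fin 3 → Fin 3 → ℝ) (W : ℝ) : Matrix (Fin 3) (Fin 3) ℝ :=
  Matrix.of fun i j => h i j / W - p i * (dot p (h j)) / W ^ 3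

lemma Am_eq {p : Fin 3 → ℝ} {h : Fin 3 → Fin 3 → ℝ} (hs : ∀ i j, h i j = h j i) {W : ℝ}
    (hW : 1 ≤ W) (hp : W ^ 2 = 1 + dot p p) :
    (1 / W) • ((1 + Matrix.of (fun i j => p i * p j))⁻¹ * Matrix.of h) = Am p h W := by
  have h1 : W ≠ 0 := by positivity
  have hinv : (1 + Matrix.of (fun i j => p i * p j) : Matrix (Fin 3) (Fin 3) ℝ)⁻¹ =
      1 - Matrix.of (fun i j => p i * p j / W ^ 2) := by
    apply Matrix.inv_eq_right_inv
    ext i j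
    have hp' : W ^ 2 = 1 + (p 0 * p 0 + p 1 * p 1 + p 2 * p 2) := hp
    have key : p i * p j - p i * p j / W ^ 2 -
        p i * p j * (p 0 * p 0 + p 1 * p 1 + p 2 * p 2) / W ^ 2 = 0 := by
      field_simp
      rw [hp']; ring
    rw [Matrix.mul_sub, Matrix.mul_one, Matrix.add_mul, Matrix.one_mul]
    simp only [Matrix.sub_apply, Matrix.add_apply, Matrix.of_apply, Matrix.mul_apply,
      Fin.sum_univ_three]
    linear_combination key
  rw [hinv]
  ext i j
  rw [Matrix.sub_mul, Matrix.one_mul]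
  simp only [Am, dot, Matrix.smul_apply, Matrix.sub_apply, Matrix.of_apply, Matrix.mul_apply,
      Fin.sum_univ_three, smul_eq_mul]
  rw [hs j 0, hs j 1, hs j 2]
  field_simp

lemma tr_sq {p : Fin 3 → ℝ} {h : Fin 3 → Fin 3 → ℝ} (hs : ∀ i j, h i j = h j i) {W : ℝ}
    (hW : 1 ≤ W) (hp : W ^ 2 = 1 + dot p p) :
    q p W⁻¹ (Am p h W 0) + q p W⁻¹ (Am p h W 1) + q p W⁻¹ (Am p h W 2) +
      q p W⁻¹ (fun j => dot p (h j) / W ^ 3) = Matrix.trace (Am p h W * Am p h W) := by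
  have h1 : W ≠ 0 := by positivity
  obtain ⟨w, hw⟩ : ∃ w, w = W⁻¹ := ⟨_, rfl⟩
  have rel : w ^ 2 * (p 0 * p 0 + p 1 * p 1 + p 2 * p 2) = 1 - w ^ 2 := by
    have : p 0 * p 0 + p 1 * p 1 + p 2 * p 2 = W ^ 2 - 1 := by simp only [dot] at hp; linarith
    rw [this, hw]; field_simp
  simp only [Matrix.trace, Matrix.diag, Matrix.mul_apply, Fin.sum_univ_three, q, Am,
    Matrix.of_apply, div_eq_mul_inv, ← inv_pow, ← hw, dot]
  rw [hs 1 0, hs 2 0, hs 2 1]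
  generalize h 0 0 = a at *
  generalize h 0 1 = b at *
  generalize h 0 2 = c at *
  generalize h 1 1 = d at *
  generalize h 1 2 = e at *
  generalize h 2 2 = f at *
  generalize p 0 = x at *
  generalize p 1 = y at *
  generalize p 2 = z at *
  clear hs hw hp h1 hW
  linear_combination (w ^ 4 * ((x * a + y * b + z * c) ^ 2 + (x * b + y * d + z * e) ^ 2 +
    (x * c + y * e + z * f) ^ 2) - w ^ 6 * (x * (x * a + y * b + z * c) +
     y * (x * b + y * d + z * e) + z * (x * c + y * e + z * f)) ^ 2) * rel

def Yr (p : Fin 3 → ℝ) (h : Fin 3 → Fin 3 → ℝ) (W : ℝ) (i : Fin 3) : Fin 3 → ℝ :=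
  fun j => h i j / (1 + W) - p i * (dot p (h j)) / (W * (1 + W) ^ 2)

lemma det_gen (p : Fin 3 → ℝ) (h : Fin 3 → Fin 3 → ℝ) (hs : ∀ i j, h i j = h j i) (a b : ℝ) :
    det3 (fun j => a * h 0 j - b * (p 0 * dot p (h j)))
     (fun j => a * h 1 j - b * (p 1 * dot p (h j)))
     (fun j => a * h 2 j - b * (p 2 * dot p (h j))) =
    a ^ 2 * (a - b * dot p p) * det3 (h 0) (h 1) (h 2) := by
  simp only [det3, dot]
  rw [hs 1 0, hs 2 0, hs 2 1]
  ring

lemma det_Y {p : Fin 3 → ℝ} {h : Fin 3 → Fin 3 → ℝ} (hs : ∀ i j, h i j = h j i) {W : ℝ}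
    (hW : 1 ≤ W) (hp : W ^ 2 = 1 + dot p p) :
    det3 (Yr p h W 0) (Yr p h W 1) (Yr p h W 2) = W * (Am p h W).det / (1 + W⁻¹) ^ 3 := by
  have h1 : W ≠ 0 := by positivity
  have h2 : 1 + W ≠ 0 := by positivity
  have h3 : 1 + W⁻¹ ≠ 0 := by positivity
  have e1 := det_gen p h hs (1 / (1 + W)) (1 / (W * (1 + W) ^ 2))
  have e2 := det_gen p h hs (1 / W) (1 / W ^ 3)
  have f1 : ∀ i, Yr p h W i = (fun j => 1 / (1 + W) * h i j -
      1 / (W * (1 + W) ^ 2) * (p i * dot p (h j))) := by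
    intro i; ext j; simp only [Yr]; ring
  have f2 : (Am p h W).det = det3 (fun j => 1 / W * h 0 j - 1 / W ^ 3 * (p 0 * dot p (h j)))
     (fun j => 1 / W * h 1 j - 1 / W ^ 3 * (p 1 * dot p (h j)))
     (fun j => 1 / W * h 2 j - 1 / W ^ 3 * (p 2 * dot p (h j))) := by
    rw [Matrix.det_fin_three]; simp only [Am, det3, Matrix.of_apply]; ring
  rw [f1, f1, f1, f2, e1, e2]
  have : dot p p = W ^ 2 - 1 := by linarith
  rw [this]
  have g1 : 1 / (1 + W) - 1 / (W * (1 + W) ^ 2) * (W ^ 2 - 1) = 1 / (W * (1 + W)) := by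
    field_simp; ring
  have g2 : 1 / W - 1 / W ^ 3 * (W ^ 2 - 1) = 1 / W ^ 3 := by
    field_simp; ring
  have g3 : 1 + W⁻¹ = (1 + W) / W := by field_simp; ring
  rw [g1, g2, g3]
  field_simp

lemma q_Y {p : Fin 3 → ℝ} {h : Fin 3 → Fin 3 → ℝ} (hs : ∀ i j, h i j = h j i) {W : ℝ}
    (hW : 1 ≤ W) (hp : W ^ 2 = 1 + dot p p) (i : Fin 3) :
    q p W⁻¹ (Yr p h W i) ≤ 2 * Matrix.trace (Am p h W * Am p h W) := by
  have h1 : W ≠ 0 := by positivity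
  have h2 : 1 + W ≠ 0 := by positivity
  have hc := q_comb hW hp (Am p h W i) (fun j => dot p (h j) / W ^ 3) (Yr p h W i)
    (W / (1 + W)) (p i * W / (1 + W) ^ 2) (by
      intro j; simp only [Yr, Am, Matrix.of_apply]; field_simp; ring)
  rw [← tr_sq hs hW hp]
  have n := fun i => q_nonneg hW hp (Am p h W i)
  have m := q_nonneg hW hp (fun j => dot p (h j) / W ^ 3)
  have b1 : (W / (1 + W)) ^ 2 ≤ 1 := by
    rw [div_pow, div_le_one (by positivity)]; nlinarith
  have hpi : p i ^ 2 ≤ W ^ 2 := by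
    rw [hp]; simp only [dot]
    fin_cases i <;> simp <;> nlinarith [sq_nonneg (p 0), sq_nonneg (p 1), sq_nonneg (p 2)]
  have b2 : (p i * W / (1 + W) ^ 2) ^ 2 ≤ 1 := by
    rw [div_pow, div_le_one (by positivity), mul_pow]
    calc p i ^ 2 * W ^ 2 ≤ W ^ 2 * W ^ 2 := by gcongr
      _ = (W ^ 2) ^ 2 := by ring
      _ ≤ ((1 + W) ^ 2) ^ 2 := by gcongr; linarith
  have n0 := n 0
  have n1 := n 1
  have n2 := n 2
  have c1 := mul_le_mul_of_nonneg_right b1 (n i)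
  have c2 := mul_le_mul_of_nonneg_right b2 m
  fin_cases i <;> simp at * <;> linarith

lemma det_bound {p : Fin 3 → ℝ} {h : Fin 3 → Fin 3 → ℝ} (hs : ∀ i j, h i j = h j i) {W : ℝ}
    (hW : 1 ≤ W) (hp : W ^ 2 = 1 + dot p p) {H : ℝ}
    (hH : Matrix.trace (Am p h W * Am p h W) = H ^ 2) (a : Fin 3 → ℝ) {β : ℝ} (hβ : 0 ≤ β)
    (ha : q p W⁻¹ a ≤ β ^ 2) :
    |det3 a (Yr p h W 1) (Yr p h W 2)| ≤ 2 * W * H ^ 2 * β := by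
  apply abs_le_of_sq_le_sq _ (by positivity)
  refine (hadamard_q hW hp _ _ _).trans ?_
  have q1 := q_Y hs hW hp 1
  have q2 := q_Y hs hW hp 2
  rw [hH] at q1 q2
  have n := fun a => q_nonneg hW hp a
  calc W ^ 2 * (q p W⁻¹ a * q p W⁻¹ (Yr p h W 1) * q p W⁻¹ (Yr p h W 2))
      ≤ W ^ 2 * (β ^ 2 * (2 * H ^ 2) * (2 * H ^ 2)) := by
        gcongr <;> exact n _
    _ = _ := by ring

/-! ### geometry of the graph -/

def W (u : E3 → ℝ) (x : E3) : ℝ := Real.sqrt (1 + ∑ i, D i u x ^ 2)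

def Hs (u : E3 → ℝ) (x : E3) : Fin 3 → Fin 3 → ℝ := fun i j => D i (D j u) x

def A (u : E3 → ℝ) (x : E3) : Matrix (Fin 3) (Fin 3) ℝ := Am (G u x) (Hs u x) (W u x)

def N (u : E3 → ℝ) (i : Fin 3) (x : E3) : ℝ := D i u x * (W u x)⁻¹

def Y (u : E3 → ℝ) (i : Fin 3) (x : E3) : ℝ := D i u x * (1 + W u x)⁻¹

def H (u : E3 → ℝ) (x : E3) : ℝ := D 0 (N u 0) x + D 1 (N u 1) x + D 2 (N u 2) x

lemma Hs_symm {u : E3 → ℝ} (hu : Sm u) (x : E3) (i j : Fin 3) : Hs u x i j = Hs u x j i :=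
  D_comm hu i j x

lemma W_sq (u : E3 → ℝ) (x : E3) : W u x ^ 2 = 1 + dot (G u x) (G u x) := by
  rw [W, Real.sq_sqrt (by positivity), Fin.sum_univ_three]
  simp only [dot, G]; ring

lemma W_ge (u : E3 → ℝ) (x : E3) : 1 ≤ W u x := by
  rw [W]; apply Real.one_le_sqrt.2
  have : 0 ≤ ∑ i, D i u x ^ 2 := by positivity
  linarith

lemma W_pos (u : E3 → ℝ) (x : E3) : 0 < W u x := lt_of_lt_of_le one_pos (W_ge u x)

lemma S_sm {u : E3 → ℝ} (hu : Sm u) : Sm (fun x => 1 + ∑ i, D i u x ^ 2) :=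
  contDiff_const.add (ContDiff.sum fun i _ => (hu.D i).pow 2)

lemma W_sm {u : E3 → ℝ} (hu : Sm u) : Sm (W u) :=
  (S_sm hu).sqrt (fun x => by positivity)

lemma N_sm {u : E3 → ℝ} (hu : Sm u) (i : Fin 3) : Sm (N u i) :=
  (hu.D i).mul ((W_sm hu).inv fun x => (W_pos u x).ne')

lemma Y_sm {u : E3 → ℝ} (hu : Sm u) (i : Fin 3) : Sm (Y u i) :=
  (hu.D i).mul ((contDiff_const.add (W_sm hu)).inv fun x => by have := W_pos u x; positivity)

lemma H_sm {u : E3 → ℝ} (hu : Sm u) : Sm (H u) :=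
  (((N_sm hu 0).D 0).add ((N_sm hu 1).D 1)).add ((N_sm hu 2).D 2)

lemma D_W {u : E3 → ℝ} (hu : Sm u) (x : E3) (j : Fin 3) :
    D j (W u) x = dot (G u x) (Hs u x j) / W u x := by
  have e : D j (fun y => 1 + ∑ i, D i u y ^ 2) x = 2 * dot (G u x) (Hs u x j) := by
    have e1 : (fun y => 1 + ∑ i, D i u y ^ 2) =
      (fun y => (fun _ => 1) y + ((D 0 u y * D 0 u y + D 1 u y * D 1 u y) + D 2 u y * D 2 u y)) := by
      ext y; rw [Fin.sum_univ_three]; ring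
    have d := fun i => (hu.D i).da x
    have dd := fun i => (d i).fun_mul (d i)
    rw [e1, D_add j (differentiableAt_const _) (((dd 0).fun_add (dd 1)).fun_add (dd 2)),
      D_add j ((dd 0).fun_add (dd 1)) (dd 2), D_add j (dd 0) (dd 1), D_mul j (d 0) (d 0),
      D_mul j (d 1) (d 1), D_mul j (d 2) (d 2)]
    have : D j (fun _ => (1:ℝ)) x = 0 := by simp [D]
    rw [this]
    simp only [dot, G, Hs]
    ring
  have hp : (1 + ∑ i, D i u x ^ 2) ≠ 0 := by positivity
  have := D_comp (f := fun y => 1 + ∑ i, D i u y ^ 2) j ((S_sm hu).da x)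
    (Real.hasDerivAt_sqrt hp)
  rw [e] at this
  have h2 : D j (W u) x = 1 / (2 * W u x) * (2 * dot (G u x) (Hs u x j)) := this
  rw [h2]
  have := (W_pos u x).ne'
  field_simp

lemma D_N {u : E3 → ℝ} (hu : Sm u) (x : E3) (i j : Fin 3) : D j (N u i) x = A u x i j := by
  have hW := (W_pos u x).ne'
  have h1 := D_comp (f := W u) j ((W_sm hu).da x) (hasDerivAt_inv hW)
  have h2 := D_mul (f := D i u) (g := fun y => (W u y)⁻¹) j ((hu.D i).da x)
    (((W_sm hu).da x).fun_inv hW)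
  have h3 : D j (N u i) x = D i u x * D j (fun y => (W u y)⁻¹) x + D j (D i u) x * (W u x)⁻¹ := h2
  rw [h3, h1, D_W hu, D_comm hu j i]
  simp only [A, Am, Matrix.of_apply, Hs, G]
  field_simp
  ring

lemma D_Y {u : E3 → ℝ} (hu : Sm u) (x : E3) (i : Fin 3) :
    G (Y u i) x = Yr (G u x) (Hs u x) (W u x) i := by
  ext j
  have hW := (W_pos u x).ne'
  have hW2 : 1 + W u x ≠ 0 := by have := W_pos u x; positivity
  have h0 : D j (fun y => 1 + W u y) x = D j (W u) x := by
    have := D_add (f := fun _ => (1:ℝ)) j (differentiableAt_const _) ((W_sm hu).da x)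
    rw [this]; simp [D]
  have hd : DifferentiableAt ℝ (fun y => 1 + W u y) x :=
    (differentiableAt_const _).fun_add ((W_sm hu).da x)
  have h1 := D_comp (f := fun y => 1 + W u y) j hd (hasDerivAt_inv hW2)
  have h2 := D_mul (f := D i u) (g := fun y => (1 + W u y)⁻¹) j ((hu.D i).da x)
    (hd.fun_inv hW2)
  have h3 : D j (Y u i) x = D i u x * D j (fun y => (1 + W u y)⁻¹) x
    + D j (D i u) x * (1 + W u x)⁻¹ := h2
  show D j (Y u i) x = _
  rw [h3, h1, h0, D_W hu, D_comm hu j i]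
  simp only [Yr, Hs, G]
  field_simp
  ring

lemma H_eq {u : E3 → ℝ} (hu : Sm u) (x : E3) : H u x = Matrix.trace (A u x) := by
  simp only [H, Matrix.trace, Fin.sum_univ_three, Matrix.diag, D_N hu]

lemma A_eq {u : E3 → ℝ} (hu : Sm u) (x : E3) :
    (1 / W u x) • ((1 + Matrix.of (fun i j => D i u x * D j u x))⁻¹ *
      Matrix.of (fun i j => D i (D j u) x)) = A u x :=
  Am_eq (Hs_symm hu x) (W_ge u x) (W_sq u x)

lemma abs_p_le (u : E3 → ℝ) (i : Fin 3) (x : E3) : |D i u x| ≤ W u x := by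
  apply abs_le_of_sq_le_sq _ (W_pos u x).le
  rw [W_sq]
  simp only [dot, G]
  fin_cases i <;> simp <;> nlinarith [sq_nonneg (D 0 u x), sq_nonneg (D 1 u x), sq_nonneg (D 2 u x)]

lemma abs_N_le (u : E3 → ℝ) (i : Fin 3) (x : E3) : |N u i x| ≤ 1 := by
  have := W_pos u x
  rw [N, abs_mul, abs_inv, abs_of_pos this, ← div_eq_mul_inv, div_le_one this]
  exact abs_p_le u i x

lemma abs_Y_le (u : E3 → ℝ) (i : Fin 3) (x : E3) : |Y u i x| ≤ 1 := by
  have := W_pos u x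
  have h2 : 0 < 1 + W u x := by linarith
  rw [Y, abs_mul, abs_inv, abs_of_pos h2, ← div_eq_mul_inv, div_le_one h2]
  linarith [abs_p_le u i x]

/-! ### cutoffs -/

def bump : ContDiffBump (0:ℝ) := ⟨1, 2, one_pos, one_lt_two⟩

def chi (s : ℝ) : ℝ := bump s

lemma chi_sm : ContDiff ℝ (⊤ : ℕ∞) chi := bump.contDiff

lemma chi_nonneg (s : ℝ) : 0 ≤ chi s := bump.nonneg

lemma chi_le (s : ℝ) : chi s ≤ 1 := bump.le_one

lemma chi_one {s : ℝ} (h0 : 0 ≤ s) (h : s ≤ 1) : chi s = 1 :=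
  bump.one_of_mem_closedBall (by simp [bump, abs_of_nonneg h0, h])

lemma chi_zero {s : ℝ} (h : 2 ≤ s) : chi s = 0 :=
  bump.zero_of_le_dist (by simpa [bump] using h.trans (le_abs_self s))

lemma chi_deriv_one {s : ℝ} (h : chi s = 1) : deriv chi s = 0 :=
  IsLocalMax.deriv_eq_zero (Filter.Eventually.of_forall fun t => by simp [h, chi_le])

lemma chi_deriv_zero {s : ℝ} (h : chi s = 0) : deriv chi s = 0 :=
  IsLocalMin.deriv_eq_zero (Filter.Eventually.of_forall fun t => by simp [h, chi_nonneg])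

lemma chi_bd : ∃ M : ℝ, 0 < M ∧ ∀ s, |deriv chi s| ≤ M := by
  have hc : Continuous (deriv chi) := chi_sm.continuous_deriv (by simp)
  have hs : HasCompactSupport (deriv chi) := (show HasCompactSupport chi from
    bump.hasCompactSupport).deriv
  obtain ⟨C, hC⟩ := hs.exists_bound_of_continuous hc
  exact ⟨max C 1, by positivity, fun s => (hC s).trans (le_max_left _ _)⟩

def cut (F : E3 → ℝ) (R : ℝ) (x : E3) : ℝ := chi (F x / R ^ 2)

lemma cut_sm {F : E3 → ℝ} (hF : Sm F) (R : ℝ) : Sm (cut F R) :=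
  chi_sm.comp (hF.div_const _)

lemma D_cut {F : E3 → ℝ} (hF : Sm F) (R : ℝ) (i : Fin 3) (x : E3) :
    D i (cut F R) x = deriv chi (F x / R ^ 2) / R ^ 2 * D i F x := by
  have h1 : HasDerivAt (fun s => chi (s / R ^ 2)) (deriv chi (F x / R ^ 2) * (1 / R ^ 2)) (F x) := by
    have a : HasDerivAt chi (deriv chi (F x / R ^ 2)) (F x / R ^ 2) :=
      ((chi_sm.differentiable (by simp)) _).hasDerivAt
    exact a.comp (F x) ((hasDerivAt_id (F x)).div_const (R ^ 2))
  have := D_comp (f := F) i (hF.da x) h1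
  show D i (fun y => chi (F y / R ^ 2)) x = _
  rw [this]; ring

lemma cut_one {F : E3 → ℝ} {R : ℝ} (hR : 0 < R) {x : E3} (h0 : 0 ≤ F x) (h : F x ≤ R ^ 2) :
    cut F R x = 1 := chi_one (by positivity) (by rw [div_le_one (by positivity)]; exact h)

lemma cut_zero {F : E3 → ℝ} {R : ℝ} (hR : 0 < R) {x : E3} (h : 2 * R ^ 2 ≤ F x) :
    cut F R x = 0 := chi_zero (by rw [le_div_iff₀ (by positivity)]; exact h)

lemma cut_nonneg (F : E3 → ℝ) (R : ℝ) (x : E3) : 0 ≤ cut F R x := chi_nonneg _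
lemma cut_le (F : E3 → ℝ) (R : ℝ) (x : E3) : cut F R x ≤ 1 := chi_le _

/-- squared norm -/
def Q (x : E3) : ℝ := dot x x

lemma Q_sm : Sm Q := by
  show ContDiff ℝ (⊤ : ℕ∞) (fun x : E3 => x 0 * x 0 + x 1 * x 1 + x 2 * x 2)
  fun_prop

lemma Q_nonneg (x : E3) : 0 ≤ Q x := dot_self_nonneg x

lemma D_Q (i : Fin 3) (x : E3) : D i Q x = 2 * x i := by
  have d : ∀ j, DifferentiableAt ℝ (fun y : E3 => y j) x := fun j => by fun_prop
  have dd := fun i => (d i).fun_mul (d i)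
  have e : Q = fun y => (y 0 * y 0 + y 1 * y 1) + y 2 * y 2 := rfl
  rw [e, D_add i ((dd 0).fun_add (dd 1)) (dd 2), D_add i (dd 0) (dd 1), D_mul i (d 0) (d 0),
      D_mul i (d 1) (d 1), D_mul i (d 2) (d 2)]
  simp only [D_coord]
  fin_cases i <;> simp <;> ring

lemma abs_le_of_Q {x : E3} {r : ℝ} (hr : 0 ≤ r) (h : Q x ≤ r ^ 2) (i : Fin 3) : |x i| ≤ r := by
  apply abs_le_of_sq_le_sq _ hr
  refine le_trans ?_ h
  simp only [Q, dot]
  fin_cases i <;> simp <;> nlinarith [sq_nonneg (x 0), sq_nonneg (x 1), sq_nonneg (x 2)]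

lemma cut_supp {F : E3 → ℝ} (hF : ∀ x, Q x ≤ F x) {R : ℝ} (hR : 0 < R) :
    HasCompactSupport (cut F R) := by
  apply HasCompactSupport.intro (isCompact_closedBall (0 : E3) (2 * R))
  intro x hx
  apply cut_zero hR
  by_contra hlt
  push Not at hlt
  apply hx
  rw [mem_closedBall_zero_iff, pi_norm_le_iff_of_nonneg (by positivity)]
  intro i
  rw [Real.norm_eq_abs]
  exact abs_le_of_Q (by positivity) (by nlinarith [hF x]) i

def Fu (u : E3 → ℝ) (x : E3) : ℝ := Q x + u x * u x

lemma Fu_sm {u : E3 → ℝ} (hu : Sm u) : Sm (Fu u) := Q_sm.add (hu.mul hu)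

lemma Q_le_Fu (u : E3 → ℝ) (x : E3) : Q x ≤ Fu u x := by
  have := mul_self_nonneg (u x)
  simp only [Fu]; linarith

lemma Fu_nonneg (u : E3 → ℝ) (x : E3) : 0 ≤ Fu u x := (Q_nonneg x).trans (Q_le_Fu u x)

lemma D_Fu {u : E3 → ℝ} (hu : Sm u) (i : Fin 3) (x : E3) :
    D i (Fu u) x = 2 * x i + 2 * u x * D i u x := by
  have := D_add i (Q_sm.da x) ((hu.da x).fun_mul (hu.da x))
  show D i (fun x => Q x + u x * u x) x = _
  rw [this, D_Q, D_mul i (hu.da x) (hu.da x)]; ring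

lemma q_Fu {u : E3 → ℝ} (hu : Sm u) (x : E3) : q (G u x) (W u x)⁻¹ (G (Fu u) x) ≤ 8 * Fu u x := by
  have h := q_comb (W_ge u x) (W_sq u x) x (G u x) (G (Fu u) x) 2 (2 * u x)
    (by intro i; exact D_Fu hu i x)
  have h1 : q (G u x) (W u x)⁻¹ x ≤ Q x := by
    simp only [q, Q]
    have : 0 ≤ (W u x)⁻¹ ^ 2 * dot x (G u x) ^ 2 := by positivity
    linarith
  have h2 : q (G u x) (W u x)⁻¹ (G u x) ≤ 1 := by
    have e : dot (G u x) (G u x) = W u x ^ 2 - 1 := by rw [W_sq]; ring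
    have hW := W_ge u x
    have h0 := (W_pos u x).ne'
    have : q (G u x) (W u x)⁻¹ (G u x) = 1 - ((W u x)⁻¹) ^ 2 := by
      simp only [q, e]; field_simp; ring
    rw [this]
    have : 0 ≤ (W u x)⁻¹ ^ 2 := by positivity
    linarith
  have h3 : 2 * (2 * u x) ^ 2 * q (G u x) (W u x)⁻¹ (G u x) ≤ 2 * (2 * u x) ^ 2 * 1 := by gcongr
  simp only [Fu]
  nlinarith

lemma range_of_ne {F : E3 → ℝ} {R : ℝ} (hR : 0 < R) {x : E3} (h0 : 0 ≤ F x)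
    (h : deriv chi (F x / R ^ 2) ≠ 0) : R ^ 2 < F x ∧ F x < 2 * R ^ 2 := by
  constructor
  · by_contra hh
    push Not at hh
    exact h (chi_deriv_one (cut_one hR h0 hh))
  · by_contra hh
    push Not at hh
    exact h (chi_deriv_zero (cut_zero hR hh))

lemma dcut_le {M : ℝ} (hM : ∀ s, |deriv chi s| ≤ M) {R : ℝ} (hR : 0 < R) (i : Fin 3) (x : E3) :
    |D i (cut Q R) x| ≤ 4 * M / R * cut Q (2 * R) x := by
  have hM0 : 0 ≤ M := (abs_nonneg _).trans (hM 0)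
  rw [D_cut Q_sm, D_Q]
  by_cases h : deriv chi (Q x / R ^ 2) = 0
  · rw [h]; simp
    have := cut_nonneg Q (2 * R) x
    positivity
  · obtain ⟨h1, h2⟩ := range_of_ne hR (Q_nonneg x) h
    rw [cut_one (by positivity) (Q_nonneg x) (by nlinarith), abs_mul, abs_div, abs_mul,
      abs_of_pos (by positivity : 0 < R ^ 2), abs_two]
    have hx := abs_le_of_Q (x := x) (r := 2 * R) (by positivity) (by nlinarith) i
    calc |deriv chi (Q x / R ^ 2)| / R ^ 2 * (2 * |x i|) ≤ M / R ^ 2 * (2 * (2 * R)) := by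
          gcongr; exact hM _
      _ = _ := by field_simp; ring

lemma int_cutQ {R : ℝ} (hR : 0 < R) : ∫ x, cut Q R x ≤ 64 * R ^ 3 := by
  have h0 : ∀ x, x ∉ Metric.closedBall (0 : E3) (2 * R) → cut Q R x = 0 := by
    intro x hx
    apply cut_zero hR
    by_contra hlt
    push Not at hlt
    apply hx
    rw [mem_closedBall_zero_iff, pi_norm_le_iff_of_nonneg (by positivity)]
    intro i
    rw [Real.norm_eq_abs]
    exact abs_le_of_Q (by positivity) (by nlinarith) i
  rw [← setIntegral_eq_integral_of_forall_compl_eq_zero h0]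
  have hv : volume (Metric.closedBall (0 : E3) (2 * R)) = ENNReal.ofReal ((2 * (2 * R)) ^ 3) := by
    rw [Real.volume_pi_closedBall _ (by positivity)]; simp
  have := norm_setIntegral_le_of_norm_le_const (μ := (volume : Measure E3)) (C := 1)
    (s := Metric.closedBall (0 : E3) (2 * R)) (f := cut Q R) (by rw [hv]; simp)
    (fun x _ => by rw [Real.norm_eq_abs, abs_of_nonneg (cut_nonneg _ _ _)]; exact cut_le _ _ _)
  refine (le_abs_self _).trans (this.trans ?_)
  rw [measureReal_def, hv, ENNReal.toReal_ofReal (by positivity)]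
  apply le_of_eq; ring

lemma int_le4 {f d a b c : E3 → ℝ} (k0 k1 k2 k3 : ℝ) (hf : Integrable f) (hd : Integrable d)
    (ha : Integrable a) (hb : Integrable b) (hc : Integrable c)
    (h : ∀ x, f x ≤ k0 * d x + k1 * a x + k2 * b x + k3 * c x) :
    ∫ x, f x ≤ k0 * (∫ x, d x) + k1 * (∫ x, a x) + k2 * (∫ x, b x) + k3 * (∫ x, c x) := by
  have i0 := hd.const_mul k0
  have i1 := ha.const_mul k1
  have i2 := hb.const_mul k2
  have i3 := hc.const_mul k3
  have i01 : Integrable (fun x => k0 * d x + k1 * a x) := i0.add i1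
  have i012 : Integrable (fun x => k0 * d x + k1 * a x + k2 * b x) := i01.add i2
  have i0123 : Integrable (fun x => k0 * d x + k1 * a x + k2 * b x + k3 * c x) := i012.add i3
  have := integral_mono hf i0123 h
  rw [integral_add i012 i3, integral_add i01 i2, integral_add i0 i1, integral_const_mul,
    integral_const_mul, integral_const_mul, integral_const_mul] at this
  linarith

lemma cutQ_int {R : ℝ} (hR : 0 < R) : Integrable (cut Q R) :=
  Sm.int (cut_sm Q_sm R).continuous (cut_supp (fun _ => le_rfl) hR)

lemma flux_le {M : ℝ} (hM : ∀ s, |deriv chi s| ≤ M) (u : E3 → ℝ) {R : ℝ} (hR : 0 < R) (x : E3)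
    {s r : ℝ} (hr : |s| ≤ r) :
    -(12 * M / R * cut Q (2 * R) x * r) ≤ s * (D 0 (cut Q R) x * N u 0 x + D 1 (cut Q R) x * N u 1 x +
      D 2 (cut Q R) x * N u 2 x) := by
  have hM0 : 0 ≤ M := (abs_nonneg _).trans (hM 0)
  have h : ∀ i, |D i (cut Q R) x * N u i x| ≤ 4 * M / R * cut Q (2 * R) x := by
    intro i
    rw [abs_mul]
    calc _ ≤ |D i (cut Q R) x| * 1 := by gcongr; exact abs_N_le u i x
      _ ≤ _ := by rw [mul_one]; exact dcut_le hM hR i x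
  have e : |D 0 (cut Q R) x * N u 0 x + D 1 (cut Q R) x * N u 1 x + D 2 (cut Q R) x * N u 2 x|
      ≤ 12 * M / R * cut Q (2 * R) x := by
    have h0 := h 0
    have h1 := h 1
    have h2 := h 2
    have := abs_add_three (D 0 (cut Q R) x * N u 0 x) (D 1 (cut Q R) x * N u 1 x)
      (D 2 (cut Q R) x * N u 2 x)
    have e : 12 * M / R * cut Q (2 * R) x = 4 * M / R * cut Q (2 * R) x +
      4 * M / R * cut Q (2 * R) x + 4 * M / R * cut Q (2 * R) x := by ring
    linarith
  refine neg_le_of_abs_le ?_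
  rw [abs_mul, mul_comm]
  have hr0 : 0 ≤ r := (abs_nonneg _).trans hr
  have := cut_nonneg Q (2 * R) x
  gcongr

lemma int_H {M : ℝ} (hM : ∀ s, |deriv chi s| ≤ M) {u : E3 → ℝ} (hu : Sm u) {s : ℝ} (hs : |s| = 1)
    (hH : ∀ x, |H u x| = s * H u x) {R : ℝ} (hR : 0 < R) :
    ∫ x, cut Q R x * |H u x| ≤ 6144 * M * R ^ 2 := by
  have hM0 : 0 ≤ M := (abs_nonneg _).trans (hM 0)
  have hη := cut_sm Q_sm R
  have hηc := cut_supp (F := Q) (fun _ => le_rfl) hR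
  have hz := int_sum3 (hη.mul (N_sm hu 0)) (hη.mul (N_sm hu 1)) (hη.mul (N_sm hu 2))
    hηc.mul_right hηc.mul_right hηc.mul_right
  have S := fun i j => (Sm.D (hη.mul (N_sm hu i)) j).continuous
  have h := int_le4 (f := fun x => cut Q R x * |H u x|)
    (d := fun x => (D 0 (fun x => cut Q R x * N u 0 x) x + D 1 (fun x => cut Q R x * N u 1 x) x
      + D 2 (fun x => cut Q R x * N u 2 x) x))
    (a := cut Q (2 * R)) (b := fun _ => 0) (c := fun _ => 0) s (12 * M / R) 0 0
    (Sm.int (hη.continuous.mul (H_sm hu).continuous.abs) hηc.mul_right)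
    (Sm.int (((S 0 0).add (S 1 1)).add (S 2 2))
      (((D_supp hηc.mul_right 0).add (D_supp hηc.mul_right 1)).add (D_supp hηc.mul_right 2)))
    (cutQ_int (by positivity)) (integrable_zero _ _ _) (integrable_zero _ _ _) (by
      intro x
      have d := fun i => D_mul i (hη.da x) ((N_sm hu i).da x)
      have fl := flux_le hM u hR x (s := s) hs.le
      simp only [d, hH]
      simp only [H]
      linarith)
  rw [hz] at h
  have h2 := int_cutQ (R := 2 * R) (by positivity)
  calc _ ≤ _ := h
    _ ≤ 12 * M / R * (64 * (2 * R) ^ 3) := by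
      simp only [mul_zero, zero_add, add_zero, zero_mul]
      gcongr
    _ = _ := by field_simp; ring

lemma cutF_sm {u : E3 → ℝ} (hu : Sm u) (R : ℝ) : Sm (cut (Fu u) R) := cut_sm (Fu_sm hu) R
lemma cutF_supp (u : E3 → ℝ) {R : ℝ} (hR : 0 < R) : HasCompactSupport (cut (Fu u) R) :=
  cut_supp (Q_le_Fu u) hR

lemma vol {M : ℝ} (hM : ∀ s, |deriv chi s| ≤ M) {u : E3 → ℝ} (hu : Sm u) {s : ℝ} (hs : |s| = 1)
    (hH : ∀ x, |H u x| = s * H u x) {R : ℝ} (hR : 0 < R) :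
    ∫ x, cut (Fu u) R x * W u x ≤ (300000 * M + 512) * R ^ 3 := by
  have hM0 : 0 ≤ M := (abs_nonneg _).trans (hM 0)
  have hR2 : 0 < 2 * R := by positivity
  have hη := cut_sm Q_sm (2 * R)
  have hηc := cut_supp (F := Q) (fun _ => le_rfl) hR2
  set T : E3 → ℝ := fun x => R * Real.arctan (u x / R) with hT
  have hTs : Sm T := contDiff_const.mul (Real.contDiff_arctan.comp (hu.div_const R))
  have hTb : ∀ x, |T x| ≤ 2 * R := by
    intro x
    rw [hT, abs_mul, abs_of_pos hR, mul_comm]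
    gcongr
    rw [abs_le]
    have := Real.pi_lt_four
    have h1 := Real.arctan_lt_pi_div_two (u x / R)
    have h2 := Real.neg_pi_div_two_lt_arctan (u x / R)
    constructor <;> linarith
  have hDT : ∀ i x, D i T x = 1 / (1 + (u x / R) ^ 2) * D i u x := by
    intro i x
    have h1 : HasDerivAt (fun t => R * Real.arctan (t / R)) (1 / (1 + (u x / R) ^ 2)) (u x) := by
      have := (((hasDerivAt_id (u x)).div_const R).arctan).const_mul R
      have e : R * (1 / (1 + (u x / R) ^ 2) * (1 / R)) = 1 / (1 + (u x / R) ^ 2) := by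
        rw [mul_comm R, mul_assoc, one_div_mul_cancel hR.ne', mul_one]
      rw [← e]
      exact this
    exact D_comp (f := u) i (hu.da x) h1
  have hTN : ∀ i, Sm (fun x => T x * N u i x) := fun i => hTs.mul (N_sm hu i)
  have hz := int_sum3 (hη.mul (hTN 0)) (hη.mul (hTN 1)) (hη.mul (hTN 2))
    hηc.mul_right hηc.mul_right hηc.mul_right
  have S := fun i j => (Sm.D (hη.mul (hTN i)) j).continuous
  have h := int_le4 (f := fun x => cut (Fu u) R x * W u x)
    (d := fun x => (D 0 (fun x => cut Q (2 * R) x * (T x * N u 0 x)) x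
      + D 1 (fun x => cut Q (2 * R) x * (T x * N u 1 x)) x
      + D 2 (fun x => cut Q (2 * R) x * (T x * N u 2 x)) x))
    (a := cut Q (2 * (2 * R))) (b := fun x => cut Q (2 * R) x * |H u x|) (c := cut Q (2 * R))
    3 (36 * M) (6 * R) 1
    (Sm.int ((cutF_sm hu R).continuous.mul (W_sm hu).continuous) (cutF_supp u hR).mul_right)
    (Sm.int (((S 0 0).add (S 1 1)).add (S 2 2))
      (((D_supp hηc.mul_right 0).add (D_supp hηc.mul_right 1)).add (D_supp hηc.mul_right 2)))
    (cutQ_int (by positivity))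
    (Sm.int (hη.continuous.mul (H_sm hu).continuous.abs) hηc.mul_right)
    (cutQ_int (by positivity)) (by
      intro x
      have d : ∀ i, D i (fun x => cut Q (2 * R) x * (T x * N u i x)) x =
          cut Q (2 * R) x * (T x * D i (N u i) x) +
          cut Q (2 * R) x * (1 / (1 + (u x / R) ^ 2)) * (D i u x * N u i x) +
          T x * (D i (cut Q (2 * R)) x * N u i x) := by
        intro i
        rw [D_mul i (hη.da x) ((hTN i).da x), D_mul i (hTs.da x) ((N_sm hu i).da x), hDT]
        ring
      simp only [d]
      have fl := flux_le hM u hR2 x (s := T x) (hTb x)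
      have hη0 := cut_nonneg Q (2 * R) x
      have hTH : -(2 * R * |H u x|) ≤ T x * H u x := by
        apply neg_le_of_abs_le
        rw [abs_mul]
        gcongr
        exact hTb x
      have hTH2 := mul_le_mul_of_nonneg_left hTH hη0
      have hW := W_ge u x
      have hW0 := (W_pos u x).ne'
      have hpN : D 0 u x * N u 0 x + D 1 u x * N u 1 x + D 2 u x * N u 2 x = W u x - (W u x)⁻¹ := by
        have : dot (G u x) (G u x) = W u x ^ 2 - 1 := by rw [W_sq]; ring
        simp only [dot, G] at this
        simp only [N]
        field_simp
        linarith
      have hi : (W u x)⁻¹ ≤ 1 := inv_le_one_of_one_le₀ hW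
      have main : cut (Fu u) R x * W u x ≤ 3 * (cut Q (2 * R) x * (1 / (1 + (u x / R) ^ 2)) *
          (W u x - (W u x)⁻¹)) + cut Q (2 * R) x := by
        have hnn : 0 ≤ 3 * (cut Q (2 * R) x * (1 / (1 + (u x / R) ^ 2)) *
          (W u x - (W u x)⁻¹)) := by
          have : 0 ≤ W u x - (W u x)⁻¹ := by linarith
          positivity
        by_cases hF : 2 * R ^ 2 ≤ Fu u x
        · rw [cut_zero hR hF, zero_mul]; linarith
        · push Not at hF
          have hQ := Q_le_Fu u x
          have h1 : cut Q (2 * R) x = 1 := cut_one hR2 (Q_nonneg x) (by nlinarith)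
          have hu2 : (u x / R) ^ 2 ≤ 2 := by
            rw [div_pow, div_le_iff₀ (by positivity)]
            have := Q_nonneg x
            simp only [Fu] at hF
            nlinarith
          have ht : 1 / 3 ≤ 1 / (1 + (u x / R) ^ 2) := by
            apply one_div_le_one_div_of_le (by positivity); linarith
          rw [h1]
          have hc := cut_le (Fu u) R x
          have := mul_le_mul_of_nonneg_right ht (by linarith : 0 ≤ W u x - (W u x)⁻¹)
          have := mul_le_mul_of_nonneg_right hc (W_pos u x).le
          linarith
      rw [← hpN] at main
      have e1 : 12 * M / (2 * R) * cut Q (2 * (2 * R)) x * (2 * R) = 12 * M * cut Q (2 * (2 * R)) x := by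
        field_simp
      rw [e1] at fl
      simp only [H] at hTH2 ⊢
      linarith)
  rw [hz] at h
  have h2 := int_cutQ (R := 2 * (2 * R)) (by positivity)
  have h3 := int_cutQ (R := 2 * R) (by positivity)
  have h4 := int_H hM hu hs hH hR2
  calc _ ≤ _ := h
    _ ≤ 3 * 0 + 36 * M * (64 * (2 * (2 * R)) ^ 3) + 6 * R * (6144 * M * (2 * R) ^ 2) +
      1 * (64 * (2 * R) ^ 3) := by gcongr
    _ = (294912 * M + 512) * R ^ 3 := by ring
    _ ≤ _ := by gcongr; norm_num

lemma young {a b t : ℝ} (ha : 0 ≤ a) (hb : 0 ≤ b) (ht : 0 < t) :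
    a ^ 2 * b ≤ t * a ^ 3 + t⁻¹ ^ 2 * b ^ 3 := by
  rcases le_total b (t * a) with h | h
  · have h1 : a ^ 2 * b ≤ a ^ 2 * (t * a) := by gcongr
    have h2 : 0 ≤ t⁻¹ ^ 2 * b ^ 3 := by positivity
    linarith
  · have h0 : a ≤ t⁻¹ * b := by
      rw [inv_mul_eq_div, le_div_iff₀ ht]; linarith
    have h1 : a ^ 2 * b ≤ (t⁻¹ * b) ^ 2 * b := by gcongr
    have h2 : 0 ≤ t * a ^ 3 := by positivity
    linarith

def Phi (u : E3 → ℝ) (R : ℝ) (x : E3) : ℝ := cut (Fu u) R x ^ 3 * Y u 0 x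

lemma Phi_sm {u : E3 → ℝ} (hu : Sm u) (R : ℝ) : Sm (Phi u R) :=
  ((cutF_sm hu R).pow 3).mul (Y_sm hu 0)

lemma cut3_supp (u : E3 → ℝ) {R : ℝ} (hR : 0 < R) :
    HasCompactSupport (fun x => cut (Fu u) R x ^ 3) :=
  (cutF_supp u hR).comp_left (g := fun t : ℝ => t ^ 3) (by simp)

lemma Phi_supp (u : E3 → ℝ) {R : ℝ} (hR : 0 < R) : HasCompactSupport (Phi u R) :=
  (cut3_supp u hR).mul_right

lemma D_Phi {u : E3 → ℝ} (hu : Sm u) (R : ℝ) (i : Fin 3) (x : E3) :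
    D i (Phi u R) x = cut (Fu u) R x ^ 3 * D i (Y u 0) x +
      3 * cut (Fu u) R x ^ 2 * Y u 0 x * D i (cut (Fu u) R) x := by
  have h1 := D_comp (f := cut (Fu u) R) i ((cutF_sm hu R).da x) (hasDerivAt_pow 3 _)
  have hd : DifferentiableAt ℝ (fun x => cut (Fu u) R x ^ 3) x := ((cutF_sm hu R).da x).fun_pow 3
  have h2 := D_mul i hd ((Y_sm hu 0).da x)
  show D i (fun x => cut (Fu u) R x ^ 3 * Y u 0 x) x = _
  rw [h2, h1]; norm_num; ring

def Dt (u : E3 → ℝ) (R : ℝ) (x : E3) : ℝ := det3 (G (Phi u R) x) (G (Y u 1) x) (G (Y u 2) x)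

lemma Dt_eq {u : E3 → ℝ} (hu : Sm u) (R : ℝ) (x : E3) :
    Dt u R x = cut (Fu u) R x ^ 3 * det3 (G (Y u 0) x) (G (Y u 1) x) (G (Y u 2) x) +
      3 * cut (Fu u) R x ^ 2 * Y u 0 x * det3 (G (cut (Fu u) R) x) (G (Y u 1) x) (G (Y u 2) x) := by
  simp only [Dt, det3, G, D_Phi hu]; ring

lemma Dt_int {u : E3 → ℝ} (hu : Sm u) {R : ℝ} (hR : 0 < R) : ∫ x, Dt u R x = 0 :=
  int_det (Phi_sm hu R) (Phi_supp u hR) (Y_sm hu 1) (Y_sm hu 2)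

lemma Dt_integrable {u : E3 → ℝ} (hu : Sm u) {R : ℝ} (hR : 0 < R) : Integrable (Dt u R) := by
  have hP := fun i => (Sm.D (Phi_sm hu R) i).continuous
  have hPs := fun i => D_supp (Phi_supp u hR) i
  have hy := fun i j => (Sm.D (Y_sm hu i) j).continuous
  apply Sm.int
  · have a0 := hP 0
    have a1 := hP 1
    have a2 := hP 2
    have b := fun j => hy 1 j
    have c := fun j => hy 2 j
    exact (((hP 0).mul (((b 1).mul (c 2)).sub ((b 2).mul (c 1)))).add
      ((hP 1).mul (((b 2).mul (c 0)).sub ((b 0).mul (c 2))))).add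
      ((hP 2).mul (((b 0).mul (c 1)).sub ((b 1).mul (c 0))))
  · exact ((HasCompactSupport.mul_right (hPs 0)).add (HasCompactSupport.mul_right (hPs 1))).add
      (HasCompactSupport.mul_right (hPs 2))

structure Hyp (u : E3 → ℝ) (c s M : ℝ) : Prop where
  sm : Sm u
  c_pos : 0 < c
  M_pos : 0 < M
  s_one : |s| = 1
  hM : ∀ t, |deriv chi t| ≤ M
  habs : ∀ x, |H u x| = s * H u x
  hne : ∀ x, H u x ≠ 0
  htr : ∀ x, Matrix.trace (A u x * A u x) = H u x ^ 2
  hK : ∀ x, c * |H u x| ^ 3 ≤ - (s * (A u x).det)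

variable {u : E3 → ℝ} {c s M : ℝ}

lemma key_pt (h : Hyp u c s M) {R : ℝ} (hR : 0 < R) (x : E3) :
    c / 8 * (cut (Fu u) R x ^ 3 * (|H u x| ^ 3 * W u x)) + s * Dt u R x ≤ 0 ∨
    ((R ^ 2 < Fu u x ∧ Fu u x < 2 * R ^ 2) ∧
    c / 8 * (cut (Fu u) R x ^ 3 * (|H u x| ^ 3 * W u x)) + s * Dt u R x ≤
      cut (Fu u) R x ^ 2 * |H u x| ^ 2 * (24 * M / R) * W u x) := by
  have hu := h.sm
  have hφ := cut_nonneg (Fu u) R x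
  have hW := W_ge u x
  have hWp := W_pos u x
  have hdet : c / 8 * (|H u x| ^ 3 * W u x) +
      s * det3 (G (Y u 0) x) (G (Y u 1) x) (G (Y u 2) x) ≤ 0 := by
    rw [D_Y hu, D_Y hu, D_Y hu, det_Y (Hs_symm hu x) hW (W_sq u x)]
    have hK := h.hK x
    have hi : (W u x)⁻¹ ≤ 1 := inv_le_one_of_one_le₀ hW
    have h8 : (1 + (W u x)⁻¹) ^ 3 ≤ 8 := by
      calc (1 + (W u x)⁻¹) ^ 3 ≤ (1 + 1) ^ 3 := by gcongr
        _ = 8 := by norm_num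
    have hpos : 0 < (1 + (W u x)⁻¹) ^ 3 := by positivity
    have hKn : 0 ≤ -(s * (A u x).det) := le_trans (by have := h.c_pos; positivity) hK
    have e1 : c * |H u x| ^ 3 / 8 ≤ -(s * (A u x).det) / (1 + (W u x)⁻¹) ^ 3 := by
      gcongr
    have e2 := mul_le_mul_of_nonneg_right e1 hWp.le
    have e3 : s * (W u x * (Am (G u x) (Hs u x) (W u x)).det / (1 + (W u x)⁻¹) ^ 3) =
      -(-(s * (A u x).det) / (1 + (W u x)⁻¹) ^ 3 * W u x) := by
      simp only [A]; ring
    rw [e3]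
    linarith
  have hdet' := mul_le_mul_of_nonneg_left hdet (by positivity : 0 ≤ cut (Fu u) R x ^ 3)
  rw [Dt_eq hu]
  by_cases hχ : deriv chi (Fu u x / R ^ 2) = 0
  · left
    have : det3 (G (cut (Fu u) R) x) (G (Y u 1) x) (G (Y u 2) x) = 0 := by
      simp only [det3, G, D_cut (Fu_sm hu), hχ]; ring
    rw [this]
    linarith
  · right
    obtain ⟨h1, h2⟩ := range_of_ne hR (Fu_nonneg u x) hχ
    refine ⟨⟨h1, h2⟩, ?_⟩
    have hM0 := h.M_pos
    have hq : q (G u x) (W u x)⁻¹ (G (cut (Fu u) R) x) ≤ (4 * M / R) ^ 2 := by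
      have e : q (G u x) (W u x)⁻¹ (G (cut (Fu u) R) x) =
          (deriv chi (Fu u x / R ^ 2) / R ^ 2) ^ 2 * q (G u x) (W u x)⁻¹ (G (Fu u) x) := by
        simp only [q, dot, G, D_cut (Fu_sm hu)]; ring
      rw [e]
      have b1 : (deriv chi (Fu u x / R ^ 2) / R ^ 2) ^ 2 ≤ (M / R ^ 2) ^ 2 := by
        rw [← sq_abs, abs_div, abs_of_pos (by positivity : 0 < R ^ 2)]
        gcongr
        exact h.hM _
      calc _ ≤ (M / R ^ 2) ^ 2 * (8 * (2 * R ^ 2)) := by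
            apply mul_le_mul b1 _ (q_nonneg hW (W_sq u x) _) (by positivity)
            exact (q_Fu hu x).trans (by linarith)
        _ = _ := by field_simp; ring
    have hb := det_bound (Hs_symm hu x) hW (W_sq u x) (h.htr x) (G (cut (Fu u) R) x)
      (by positivity) hq
    rw [← D_Y hu, ← D_Y hu] at hb
    have hb2 : s * (3 * cut (Fu u) R x ^ 2 * Y u 0 x *
        det3 (G (cut (Fu u) R) x) (G (Y u 1) x) (G (Y u 2) x)) ≤
        3 * cut (Fu u) R x ^ 2 * (2 * W u x * H u x ^ 2 * (4 * M / R)) := by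
      refine (le_abs_self _).trans ?_
      rw [abs_mul, h.s_one, one_mul, abs_mul, abs_mul,
        abs_of_nonneg (by positivity : 0 ≤ 3 * cut (Fu u) R x ^ 2)]
      calc _ ≤ 3 * cut (Fu u) R x ^ 2 * 1 * (2 * W u x * H u x ^ 2 * (4 * M / R)) := by
            gcongr
            exact abs_Y_le u 0 x
        _ = _ := by ring
    have e4 : cut (Fu u) R x ^ 2 * |H u x| ^ 2 * (24 * M / R) * W u x =
      3 * cut (Fu u) R x ^ 2 * (2 * W u x * H u x ^ 2 * (4 * M / R)) := by
      rw [sq_abs]; ring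
    rw [e4]
    linarith

/-- the total cut-off curvature -/
def a (u : E3 → ℝ) (R : ℝ) : ℝ := ∫ x, cut (Fu u) R x ^ 3 * (|H u x| ^ 3 * W u x)

lemma a_cont (hu : Sm u) (R : ℝ) :
    Continuous (fun x => cut (Fu u) R x ^ 3 * (|H u x| ^ 3 * W u x)) :=
  ((cutF_sm hu R).continuous.pow 3).mul
    (((H_sm hu).continuous.abs.pow 3).mul (W_sm hu).continuous)

lemma a_int (hu : Sm u) {R : ℝ} (hR : 0 < R) :
    Integrable (fun x => cut (Fu u) R x ^ 3 * (|H u x| ^ 3 * W u x)) :=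
  Sm.int (a_cont hu R) (cut3_supp u hR).mul_right

lemma v_int (hu : Sm u) {R : ℝ} (hR : 0 < R) :
    Integrable (fun x => cut (Fu u) R x * W u x) :=
  Sm.int ((cutF_sm hu R).continuous.mul (W_sm hu).continuous) (cutF_supp u hR).mul_right

lemma step1 (h : Hyp u c s M) {R : ℝ} (hR : 0 < R) :
    a u R ≤ 16 / c * ((c / 16)⁻¹ ^ 2 * (24 * M) ^ 3 * (8 * (300000 * M + 512))) := by
  have hu := h.sm
  have hc := h.c_pos
  have hM0 := h.M_pos
  have hR2 : 0 < 2 * R := by positivity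
  have hi := int_le4 (f := fun x => cut (Fu u) R x ^ 3 * (|H u x| ^ 3 * W u x)) (d := Dt u R)
    (a := fun x => cut (Fu u) (2 * R) x * W u x) (b := fun _ => 0) (c := fun _ => 0)
    (-(16 / c * s)) (16 / c * ((c / 16)⁻¹ ^ 2 * (24 * M / R) ^ 3)) 0 0 (a_int hu hR)
    (Dt_integrable hu hR) (v_int hu hR2) (integrable_zero _ _ _) (integrable_zero _ _ _) (by
      intro x
      have hWp := W_pos u x
      have n1 := cut_nonneg (Fu u) R x
      have n2 := cut_nonneg (Fu u) (2 * R) x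
      have key : c / 8 * (cut (Fu u) R x ^ 3 * (|H u x| ^ 3 * W u x)) + s * Dt u R x ≤
          c / 16 * (cut (Fu u) R x ^ 3 * (|H u x| ^ 3 * W u x)) +
          (c / 16)⁻¹ ^ 2 * (24 * M / R) ^ 3 * (cut (Fu u) (2 * R) x * W u x) := by
        rcases key_pt h hR x with h1 | ⟨⟨h1, h2⟩, h3⟩
        · refine h1.trans (by positivity)
        · refine h3.trans ?_
          rw [cut_one hR2 (Fu_nonneg u x) (by nlinarith)]
          have := young (a := cut (Fu u) R x * |H u x|) (b := 24 * M / R) (t := c / 16)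
            (by positivity) (by positivity) (by positivity)
          have := mul_le_mul_of_nonneg_right this hWp.le
          calc _ = (cut (Fu u) R x * |H u x|) ^ 2 * (24 * M / R) * W u x := by ring
            _ ≤ _ := this
            _ = _ := by ring
      have k2 := mul_le_mul_of_nonneg_left key (by positivity : 0 ≤ 16 / c)
      have e1 : 16 / c * (c / 8 * (cut (Fu u) R x ^ 3 * (|H u x| ^ 3 * W u x)) + s * Dt u R x) =
         2 * (cut (Fu u) R x ^ 3 * (|H u x| ^ 3 * W u x)) + 16 / c * s * Dt u R x := by
        field_simp; ring
      have e2 : 16 / c * (c / 16 * (cut (Fu u) R x ^ 3 * (|H u x| ^ 3 * W u x)) +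
          (c / 16)⁻¹ ^ 2 * (24 * M / R) ^ 3 * (cut (Fu u) (2 * R) x * W u x)) =
          cut (Fu u) R x ^ 3 * (|H u x| ^ 3 * W u x) +
          16 / c * ((c / 16)⁻¹ ^ 2 * (24 * M / R) ^ 3) * (cut (Fu u) (2 * R) x * W u x) := by
        field_simp
      rw [e1, e2] at k2
      linarith)
  rw [Dt_int hu hR] at hi
  have hv := vol h.hM hu h.s_one h.habs hR2
  calc a u R ≤ _ := hi
    _ = 16 / c * ((c / 16)⁻¹ ^ 2 * (24 * M / R) ^ 3) * (∫ x, cut (Fu u) (2 * R) x * W u x) := by simp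
    _ ≤ 16 / c * ((c / 16)⁻¹ ^ 2 * (24 * M / R) ^ 3) * ((300000 * M + 512) * (2 * R) ^ 3) := by
      gcongr
    _ = _ := by field_simp; ring

lemma cut_mono {R : ℝ} (hR : 0 < R) (x : E3) : cut (Fu u) R x ≤ cut (Fu u) (2 * R) x := by
  by_cases hF : 2 * R ^ 2 ≤ Fu u x
  · rw [cut_zero hR hF]; exact cut_nonneg _ _ _
  · push Not at hF
    rw [cut_one (R := 2 * R) (by positivity) (Fu_nonneg u x) (by nlinarith)]
    exact cut_le _ _ _

lemma a_mono (hu : Sm u) {R : ℝ} (hR : 0 < R) : a u R ≤ a u (2 * R) := by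
  apply integral_mono (a_int hu hR) (a_int hu (by positivity))
  intro x
  have := W_pos u x
  have := cut_nonneg (Fu u) R x
  have := cut_mono (u := u) hR x
  dsimp only
  gcongr

lemma step2 (h : Hyp u c s M) {R : ℝ} (hR : 0 < R) {t : ℝ} (ht : 0 < t) :
    c / 8 * a u (2 * R) ≤ t * (a u (2 * (2 * R)) - a u R) +
      t⁻¹ ^ 2 * ((24 * M) ^ 3 * (8 * (300000 * M + 512))) := by
  have hu := h.sm
  have hc := h.c_pos
  have hM0 := h.M_pos
  have hR2 : 0 < 2 * R := by positivity
  have hR4 : 0 < 2 * (2 * R) := by positivity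
  have hi := int_le4 (f := fun x => c / 8 * (cut (Fu u) (2 * R) x ^ 3 * (|H u x| ^ 3 * W u x)))
    (d := Dt u (2 * R))
    (a := fun x => cut (Fu u) (2 * (2 * R)) x * W u x)
    (b := fun x => cut (Fu u) (2 * (2 * R)) x ^ 3 * (|H u x| ^ 3 * W u x))
    (c := fun x => cut (Fu u) R x ^ 3 * (|H u x| ^ 3 * W u x))
    (-s) (t⁻¹ ^ 2 * (24 * M / (2 * R)) ^ 3) t (-t) ((a_int hu hR2).const_mul _)
    (Dt_integrable hu hR2) (v_int hu hR4) (a_int hu hR4) (a_int hu hR) (by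
      intro x
      have hWp := W_pos u x
      have n1 := cut_nonneg (Fu u) (2 * R) x
      have n0 := cut_nonneg (Fu u) R x
      have n2 := cut_nonneg (Fu u) (2 * (2 * R)) x
      have key : c / 8 * (cut (Fu u) (2 * R) x ^ 3 * (|H u x| ^ 3 * W u x)) + s * Dt u (2 * R) x ≤
          t⁻¹ ^ 2 * (24 * M / (2 * R)) ^ 3 * (cut (Fu u) (2 * (2 * R)) x * W u x) +
          t * ((cut (Fu u) (2 * (2 * R)) x ^ 3 - cut (Fu u) R x ^ 3) * (|H u x| ^ 3 * W u x)) := by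
        rcases key_pt h hR2 x with h1 | ⟨⟨h1, h2⟩, h3⟩
        · refine h1.trans ?_
          have : cut (Fu u) R x ≤ cut (Fu u) (2 * (2 * R)) x :=
            (cut_mono hR x).trans (cut_mono hR2 x)
          have : 0 ≤ cut (Fu u) (2 * (2 * R)) x ^ 3 - cut (Fu u) R x ^ 3 := by
            rw [sub_nonneg]; gcongr
          positivity
        · refine h3.trans ?_
          rw [cut_one hR4 (Fu_nonneg u x) (by nlinarith), cut_zero hR (by nlinarith)]
          have := young (a := |H u x|) (b := 24 * M / (2 * R)) (t := t)
            (by positivity) (by positivity) (by positivity)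
          have := mul_le_mul_of_nonneg_right this hWp.le
          have hle := cut_le (Fu u) (2 * R) x
          calc _ ≤ 1 ^ 2 * |H u x| ^ 2 * (24 * M / (2 * R)) * W u x := by gcongr
            _ = |H u x| ^ 2 * (24 * M / (2 * R)) * W u x := by ring
            _ ≤ _ := this
            _ = _ := by ring
      linarith)
  rw [Dt_int hu hR2, integral_const_mul] at hi
  have hv := vol h.hM hu h.s_one h.habs hR4
  have hv2 : t⁻¹ ^ 2 * (24 * M / (2 * R)) ^ 3 * (∫ x, cut (Fu u) (2 * (2 * R)) x * W u x) ≤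
      t⁻¹ ^ 2 * ((24 * M) ^ 3 * (8 * (300000 * M + 512))) := by
    calc _ ≤ t⁻¹ ^ 2 * (24 * M / (2 * R)) ^ 3 * ((300000 * M + 512) * (2 * (2 * R)) ^ 3) := by
          gcongr
      _ = _ := by field_simp; ring
  simp only [a] at hi ⊢
  linarith

lemma contra (h : Hyp u c s M) : False := by
  have hu := h.sm
  have hc := h.c_pos
  have hM0 := h.M_pos
  set R0 : ℝ := 1 + |u 0| with hR0
  have hR0p : 0 < R0 := by positivity
  have hpos : 0 < a u R0 := by
    apply (a_cont hu R0).integral_pos_of_hasCompactSupport_nonneg_nonzero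
      (cut3_supp u hR0p).mul_right (x := 0)
    · intro x
      have := W_pos u x
      have := cut_nonneg (Fu u) R0 x
      simp only [Pi.zero_apply]
      positivity
    · have h1 : cut (Fu u) R0 0 = 1 := by
        apply cut_one hR0p (Fu_nonneg _ _)
        simp only [Fu, Q, dot, Pi.zero_apply]
        rw [hR0]
        nlinarith [abs_nonneg (u 0), abs_mul_abs_self (u 0)]
      have := W_pos u 0
      have := abs_pos.2 (h.hne 0)
      rw [h1]
      positivity
  set K3 := (24 * M) ^ 3 * (8 * (300000 * M + 512)) with hK3
  have hK3p : 0 < K3 := by positivity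
  set t : ℝ := 1 + 16 * K3 / (c * a u R0) with ht
  have htp : 0 < t := by positivity
  have ht1 : 1 ≤ t := by
    have : 0 < 16 * K3 / (c * a u R0) := by positivity
    linarith
  have htK : t⁻¹ ^ 2 * K3 ≤ c / 16 * a u R0 := by
    have h1 : t⁻¹ ^ 2 ≤ t⁻¹ := by
      have : t⁻¹ ≤ 1 := inv_le_one_of_one_le₀ ht1
      have : 0 < t⁻¹ := by positivity
      nlinarith
    have h2 : t⁻¹ * K3 ≤ c / 16 * a u R0 := by
      rw [inv_mul_le_iff₀ htp, ht]
      have : (1 + 16 * K3 / (c * a u R0)) * (c / 16 * a u R0) = c / 16 * a u R0 + K3 := by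
        field_simp
      rw [this]
      have : 0 < c / 16 * a u R0 := by positivity
      linarith
    have := mul_le_mul_of_nonneg_right h1 hK3p.le
    linarith
  set ε := c / 16 * a u R0 / t with hε
  have hεp : 0 < ε := by positivity
  have step : ∀ R, 0 < R → a u R0 ≤ a u R → a u R + ε ≤ a u (2 * (2 * R)) := by
    intro R hR hle
    have h2 := step2 h hR htp
    have h3 := a_mono hu hR
    have h4 : c / 16 * a u R0 ≤ t * (a u (2 * (2 * R)) - a u R) := by
      have : c / 8 * a u R0 ≤ c / 8 * a u (2 * R) := by gcongr; linarith
      linarith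
    have h5 : ε ≤ a u (2 * (2 * R)) - a u R := by
      rw [hε, div_le_iff₀ htp]; linarith
    linarith
  have ind : ∀ k : ℕ, ∃ R, 0 < R ∧ a u R0 + k * ε ≤ a u R := by
    intro k
    induction k with
    | zero => exact ⟨R0, hR0p, by simp⟩
    | succ k ih =>
      obtain ⟨R, hR, hk⟩ := ih
      refine ⟨2 * (2 * R), by positivity, ?_⟩
      have : 0 ≤ k * ε := by positivity
      have := step R hR (by linarith)
      push_cast
      linarith
  obtain ⟨k, hk⟩ := exists_nat_gt
    (16 / c * ((c / 16)⁻¹ ^ 2 * (24 * M) ^ 3 * (8 * (300000 * M + 512))) / ε)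
  rw [div_lt_iff₀ hεp] at hk
  obtain ⟨R, hR, h1⟩ := ind k
  have := step1 h hR
  linarith

lemma final (hu : Sm u) (hc : 0 < c) (h1 : ∀ x, H u x ≠ 0)
    (h2 : ∀ x, Matrix.trace (A u x * A u x) = H u x ^ 2)
    (h3 : ∀ x, c ≤ -(A u x).det / H u x ^ 3) : False := by
  obtain ⟨M, hM0, hM⟩ := chi_bd
  have hcont := (H_sm hu).continuous
  by_cases hp : 0 < H u 0
  · have hall : ∀ x, 0 < H u x := by
      intro x
      by_contra hn
      push Not at hn
      obtain ⟨y, hy⟩ := mem_range_of_exists_le_of_exists_ge hcont ⟨x, hn⟩ ⟨0, hp.le⟩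
      exact h1 y hy
    refine contra (u := u) (c := c) (s := 1) (M := M) ⟨hu, hc, hM0, by simp, hM, ?_, h1, h2, ?_⟩
    · intro x; rw [abs_of_pos (hall x), one_mul]
    · intro x
      have := h3 x
      have hx := hall x
      rw [le_div_iff₀ (by positivity)] at this
      rw [abs_of_pos hx]; linarith
  · have hall : ∀ x, H u x < 0 := by
      intro x
      by_contra hn
      push Not at hn hp
      obtain ⟨y, hy⟩ := mem_range_of_exists_le_of_exists_ge hcont ⟨0, hp⟩ ⟨x, hn⟩
      exact h1 y hy
    refine contra (u := u) (c := c) (s := -1) (M := M) ⟨hu, hc, hM0, by simp, hM, ?_, h1, h2, ?_⟩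
    · intro x; rw [abs_of_neg (hall x)]; ring
    · intro x
      have := h3 x
      have hx : 0 < - H u x := by linarith [hall x]
      have e : -(A u x).det / H u x ^ 3 = (A u x).det / (- H u x) ^ 3 := by
        rw [Odd.neg_pow (by decide), div_neg, neg_div]
      rw [e, le_div_iff₀ (by positivity)] at this
      rw [abs_of_neg (hall x)]; linarith

end Bern
end

/-- Bernstein-type theorem: there is no entire graph `{(x, u(x)) : x ∈ ℝ³} ⊂ ℝ⁴`
with zero scalar curvature and `(−K)/H³ ≥ c > 0` everywhere. Here, with
`W = √(1+‖∇u‖²)` and `g = I + ∇u·∇uᵀ`, the shape operator is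
`A = (1/W)·g⁻¹·D²u`, `H = tr A`, the scalar curvature is
`σ₂(A) = ((tr A)² − tr(A²))/2` and `K = det A`. -/
theorem no_entire_graph_zero_scalar_curvature_pinched :
    ¬ ∃ (u : (Fin 3 → ℝ) → ℝ) (c : ℝ),
        ContDiff ℝ (⊤ : ℕ∞) u ∧ 0 < c ∧
        ∀ x : Fin 3 → ℝ,
          (fun (gradu : Fin 3 → ℝ) =>
            (fun (D2u : Matrix (Fin 3) (Fin 3) ℝ) =>
              (fun (W : ℝ) =>
                (fun (g : Matrix (Fin 3) (Fin 3) ℝ) =>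
                  (fun (A : Matrix (Fin 3) (Fin 3) ℝ) =>
                    ((Matrix.trace A) ^ 2 - Matrix.trace (A * A)) / 2 = 0 ∧
                    Matrix.trace A ≠ 0 ∧
                    c ≤ -(A.det) / (Matrix.trace A) ^ 3)
                  ((1 / W) • (g⁻¹ * D2u)))
                (1 + Matrix.of (fun i j => gradu i * gradu j)))
              (Real.sqrt (1 + ∑ i, gradu i ^ 2)))
            (Matrix.of (fun i j =>
              fderiv ℝ (fun y => fderiv ℝ u y (Pi.single j 1)) x (Pi.single i 1))))
          (fun i => fderiv ℝ u x (Pi.single i 1)) := by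
  rintro ⟨u, c, hu, hc, h⟩
  have key : ∀ x, ((Matrix.trace (Bern.A u x)) ^ 2 - Matrix.trace (Bern.A u x * Bern.A u x)) / 2 = 0 ∧
      Matrix.trace (Bern.A u x) ≠ 0 ∧
      c ≤ -((Bern.A u x).det) / (Matrix.trace (Bern.A u x)) ^ 3 := by
    intro x
    rw [← Bern.A_eq hu x]
    exact h x
  refine Bern.final hu hc (fun x => ?_) (fun x => ?_) (fun x => ?_)
  · rw [Bern.H_eq hu]; exact (key x).2.1
  · rw [Bern.H_eq hu]; linarith [(key x).1]
  · rw [Bern.H_eq hu]; exact (key x).2.2
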